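/- Let (X,d) be a compact (R,D)-thin metric space. Let l : [0,Λ] → X be a segment of maximal length in X (every segment in X has length ≤ Λ) and assume Λ ≥ 10R. Let p ∈ X with dist(p, l([0,Λ])) ≥ 10R, let γ₁ be a segment connecting p and l(Λ), and let γ₂ be a segment connecting p and l(0). Then for any two distinct b₁, b₂ ∈ {γ₁, γ₂, l}, writing b₁ : [0, L₁] → X, one has π_{b₁}(image(b₂)) ⊆ b₁([0, 3R]) ∪ b₁([L₁ − 3R, L₁]). -/

import Mathlib

open Metric Set

/-- `l` restricted to `[a, b]` is a unit-speed segment (isometric embedding of `[a,b]`). -/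
def IsSegmentOn {X : Type*} [PseudoMetricSpace X] (l : ℝ → X) (a b : ℝ) : Prop :=
  ∀ s ∈ Set.Icc a b, ∀ t ∈ Set.Icc a b, dist (l s) (l t) = |s - t|

/-- A ray in `X`: an isometric embedding of `[0, ∞)`. -/
def IsRay {X : Type*} [PseudoMetricSpace X] (r : ℝ → X) : Prop :=
  ∀ s t : ℝ, 0 ≤ s → 0 ≤ t → dist (r s) (r t) = |s - t|

/-- `X` is a geodesic space: any two points are joined by a segment. -/
def IsGeodesicSpace (X : Type*) [PseudoMetricSpace X] : Prop :=
  ∀ x y : X, ∃ f : ℝ → X, IsSegmentOn f 0 (dist x y) ∧ f 0 = x ∧ f (dist x y) = y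

/-- The metric projection of a point `x` to a set `K`:
the set of points of `K` realizing the distance from `x` to `K`. -/
def metricProj {X : Type*} [PseudoMetricSpace X] (K : Set X) (x : X) : Set X :=
  {y ∈ K | dist x y = Metric.infDist x K}

/-- The metric projection of a set `A` to a set `K`. -/
def metricProjSet {X : Type*} [PseudoMetricSpace X] (K A : Set X) : Set X :=
  ⋃ x ∈ A, metricProj K x

/-- `S` contains a `c`-net of `T`: every point of `T` is within distance `c` of `S`. -/
def ContainsNetOf {X : Type*} [PseudoMetricSpace X] (S T : Set X) (c : ℝ) : Prop :=
  ∀ p ∈ T, ∃ q ∈ S, dist p q ≤ c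

/-- An `(R,D)`-thin metric space: a proper, separable, geodesic metric space
(with `R ≥ 20 D > 0`) such that for every segment `l` of length `L > 2R`, every
`t ∈ (R, L - R)` and every `x` whose projection to `l` meets `l(t)`, one has
`dist(x, l) < D`. -/
structure IsThinSpace (X : Type*) [MetricSpace X] (R D : ℝ) : Prop where
  R_pos : 0 < R
  D_pos : 0 < D
  twentyD_le_R : 20 * D ≤ R
  proper : ProperSpace X
  separable : TopologicalSpace.SeparableSpace X
  geodesic : IsGeodesicSpace X
  thin : ∀ (l : ℝ → X) (L : ℝ), 2 * R < L → IsSegmentOn l 0 L →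
    ∀ t ∈ Set.Ioo R (L - R), ∀ x : X,
      dist x (l t) = Metric.infDist x (l '' Set.Icc 0 L) →
      Metric.infDist x (l '' Set.Icc 0 L) < D

namespace IsSegmentOn

variable {X : Type*} [PseudoMetricSpace X] {l : ℝ → X} {a b : ℝ}

lemma continuousOn (hl : IsSegmentOn l a b) : ContinuousOn l (Icc a b) := by
  have h : LipschitzOnWith 1 l (Icc a b) := LipschitzOnWith.of_dist_le_mul fun s hs t ht => by
    simp [hl s hs t ht, Real.dist_eq]
  exact h.continuousOn

lemma dist_eq_sub (hl : IsSegmentOn l a b) {s t : ℝ} (has : a ≤ s) (hst : s ≤ t) (htb : t ≤ b) :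
    dist (l s) (l t) = t - s := by
  rw [hl s ⟨has, hst.trans htb⟩ t ⟨has.trans hst, htb⟩, abs_sub_comm, abs_of_nonneg (by linarith)]

lemma reverse {L : ℝ} (hl : IsSegmentOn l 0 L) : IsSegmentOn (fun t => l (L - t)) 0 L := by
  intro s hs t ht
  rw [mem_Icc] at hs ht
  rw [hl _ ⟨by linarith, by linarith⟩ _ ⟨by linarith, by linarith⟩, abs_sub_comm]
  congr 1
  ring

end IsSegmentOn

lemma image_Icc_zero_sub {X : Type*} (l : ℝ → X) (L : ℝ) :
    (fun t => l (L - t)) '' Icc 0 L = l '' Icc 0 L := by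
  have h : (fun t => l (L - t)) = l ∘ fun t => L - t := rfl
  rw [h, image_comp]
  simp

/-- A path in a thin space that passes from the `D`-neighbourhood of a long segment to its
complement comes within `D` of one of the two end pieces of length `R` of that segment. -/
lemma IsThinSpace.exists_dist_end_le {X : Type*} [MetricSpace X] {R D : ℝ}
    (hX : IsThinSpace X R D) {l : ℝ → X} {L : ℝ} (hL : 2 * R < L) (hl : IsSegmentOn l 0 L)
    {γ : ℝ → X} {α β : ℝ} (hγ : ContinuousOn γ (Icc α β)) {x y : ℝ}
    (hx : x ∈ Icc α β) (hy : y ∈ Icc α β)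
    (hxD : infDist (γ x) (l '' Icc 0 L) < D) (hyD : D ≤ infDist (γ y) (l '' Icc 0 L)) :
    ∃ u ∈ Icc α β, ∃ w ∈ Icc 0 L, (w ≤ R ∨ L - R ≤ w) ∧ dist (γ u) (l w) ≤ D := by
  have hR := hX.R_pos
  obtain ⟨u, hu, hu_eq⟩ := isPreconnected_Icc.intermediate_value hx hy
    ((continuous_infDist_pt (l '' Icc 0 L)).comp_continuousOn hγ) ⟨hxD.le, hyD⟩
  simp only [Function.comp_apply] at hu_eq
  have hcpt : IsCompact (l '' Icc 0 L) := isCompact_Icc.image_of_continuousOn hl.continuousOn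
  obtain ⟨_, ⟨w, hw, rfl⟩, hw_eq⟩ := hcpt.exists_infDist_eq_dist
    (⟨l 0, 0, ⟨le_rfl, by linarith⟩, rfl⟩ : (l '' Icc 0 L).Nonempty) (γ u)
  refine ⟨u, hu, w, hw, ?_, by linarith⟩
  by_contra! h
  have := hX.thin l L hL hl w ⟨h.1, h.2⟩ (γ u) hw_eq.symm
  linarith

section Triangle

variable {X : Type*} [MetricSpace X] {R D : ℝ} {l : ℝ → X} {Λ : ℝ} {γ : ℝ → X} {L : ℝ}

/-- A segment no longer than `l` that starts far away from `l` and ends at `l Λ` is close to `l`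
only near its endpoint. -/
lemma IsThinSpace.sub_le_of_infDist_lt (hX : IsThinSpace X R D) (hΛ : 10 * R ≤ Λ)
    (hl : IsSegmentOn l 0 Λ) (hLΛ : L ≤ Λ) (hp : 10 * R ≤ infDist (γ 0) (l '' Icc 0 Λ))
    (hγ : IsSegmentOn γ 0 L) (hγL : γ L = l Λ) {s : ℝ} (hs : s ∈ Icc 0 L)
    (hsD : infDist (γ s) (l '' Icc 0 Λ) < D) : L - s ≤ R + D := by
  have hR := hX.R_pos
  have hD := hX.D_pos
  have hRD := hX.twentyD_le_R
  obtain ⟨u, hu, w, hw, hwR, huw⟩ := hX.exists_dist_end_le (by linarith) hl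
    (hγ.continuousOn.mono (Icc_subset_Icc_right hs.2)) (right_mem_Icc.2 hs.1)
    (left_mem_Icc.2 hs.1) hsD (by linarith)
  have hu0 := hγ.dist_eq_sub le_rfl hu.1 (hu.2.trans hs.2)
  have huL := hγ.dist_eq_sub hu.1 (hu.2.trans hs.2) le_rfl
  have hwΛ := hl.dist_eq_sub hw.1 hw.2 le_rfl
  rw [hγL] at huL
  rcases hwR with hwR | hwR
  · have h1 := infDist_le_dist_of_mem (x := γ 0) (mem_image_of_mem l hw)
    have h2 := dist_triangle (γ 0) (γ u) (l w)
    have h3 := dist_triangle_left (l w) (l Λ) (γ u)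
    linarith
  · have h1 := dist_triangle (γ u) (l w) (l Λ)
    have h2 := hu.2
    linarith

lemma IsThinSpace.proj_base_near_ends (hX : IsThinSpace X R D) (hΛ : 10 * R ≤ Λ)
    (hl : IsSegmentOn l 0 Λ) (hLΛ : L ≤ Λ) (hp : 10 * R ≤ infDist (γ 0) (l '' Icc 0 Λ))
    (hγ : IsSegmentOn γ 0 L) (hγL : γ L = l Λ) {s t : ℝ} (hs : s ∈ Icc 0 L) (ht : t ∈ Icc 0 Λ)
    (hst : dist (γ s) (l t) = infDist (γ s) (l '' Icc 0 Λ)) : t ≤ 3 * R ∨ Λ - 3 * R ≤ t := by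
  have hR := hX.R_pos
  have hRD := hX.twentyD_le_R
  by_contra! h
  have hD := hX.thin l Λ (by linarith) hl t ⟨by linarith, by linarith⟩ _ hst
  have h1 := hX.sub_le_of_infDist_lt hΛ hl hLΛ hp hγ hγL hs hD
  have h2 := hγ.dist_eq_sub hs.1 hs.2 le_rfl
  have h3 := hl.dist_eq_sub ht.1 ht.2 le_rfl
  have h4 := dist_triangle_left (l t) (l Λ) (γ s)
  rw [hγL] at h2
  linarith

lemma IsThinSpace.proj_side_near_ends (hX : IsThinSpace X R D) (hΛ : 10 * R ≤ Λ)
    (hl : IsSegmentOn l 0 Λ) (hLΛ : L ≤ Λ) (hp : 10 * R ≤ infDist (γ 0) (l '' Icc 0 Λ))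
    (hγ : IsSegmentOn γ 0 L) (hγL : γ L = l Λ) {s t : ℝ} (hs : s ∈ Icc 0 L) (ht : t ∈ Icc 0 Λ)
    (hts : dist (l t) (γ s) = infDist (l t) (γ '' Icc 0 L)) : s ≤ 3 * R ∨ L - 3 * R ≤ s := by
  have hR := hX.R_pos
  have hRD := hX.twentyD_le_R
  by_contra! h
  have hD := hX.thin γ L (by linarith) hγ s ⟨by linarith, by linarith⟩ _ hts
  have h1 := infDist_le_dist_of_mem (x := γ s) (mem_image_of_mem l ht)
  rw [dist_comm] at h1
  have h2 := hX.sub_le_of_infDist_lt hΛ hl hLΛ hp hγ hγL hs (by linarith)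
  linarith

lemma IsThinSpace.proj_side_side_near_ends (hX : IsThinSpace X R D) (hΛ : 10 * R ≤ Λ)
    (hl : IsSegmentOn l 0 Λ) (hLΛ : L ≤ Λ) (hp : 10 * R ≤ infDist (γ 0) (l '' Icc 0 Λ))
    (hγ : IsSegmentOn γ 0 L) (hγL : γ L = l Λ) {γ' : ℝ → X} {L' : ℝ} (hLΛ' : L' ≤ Λ)
    (hγ' : IsSegmentOn γ' 0 L') (h0 : γ' 0 = γ 0) (hγL' : γ' L' = l 0)
    {s v : ℝ} (hs : s ∈ Icc 0 L) (hv : v ∈ Icc 0 L')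
    (hvs : dist (γ' v) (γ s) = infDist (γ' v) (γ '' Icc 0 L)) : s ≤ 3 * R ∨ L - 3 * R ≤ s := by
  have hR := hX.R_pos
  have hD := hX.D_pos
  have hRD := hX.twentyD_le_R
  have hΛ0 : 0 ≤ Λ := by linarith
  have hlΛ := hl.dist_eq_sub le_rfl hΛ0 le_rfl
  by_contra! h
  have hvD := hX.thin γ L (by linarith) hγ s ⟨by linarith, by linarith⟩ _ hvs
  have hfar : D ≤ infDist (γ' L') (γ '' Icc 0 L) := by
    by_contra! hlt
    obtain ⟨_, ⟨r, hr, rfl⟩, hrD⟩ :=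
      (infDist_lt_iff (⟨γ s, s, hs, rfl⟩ : (γ '' Icc 0 L).Nonempty)).1 hlt
    rw [hγL'] at hrD
    have h1 := infDist_le_dist_of_mem (x := γ r)
      (mem_image_of_mem l (left_mem_Icc.2 hΛ0))
    rw [dist_comm] at h1
    have h2 := hX.sub_le_of_infDist_lt hΛ hl hLΛ hp hγ hγL hr (by linarith)
    have h3 := hγ.dist_eq_sub hr.1 hr.2 le_rfl
    have h4 := dist_triangle (l 0) (γ r) (l Λ)
    rw [hγL] at h3
    linarith
  obtain ⟨u, hu, w, hw, hwR, huw⟩ := hX.exists_dist_end_le (by linarith) hγ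
    (hγ'.continuousOn.mono (Icc_subset_Icc_left hv.1)) (left_mem_Icc.2 hv.2)
    (right_mem_Icc.2 hv.2) hvD hfar
  have hu0 := hγ'.dist_eq_sub le_rfl (hv.1.trans hu.1) hu.2
  have hw0 := hγ.dist_eq_sub le_rfl hw.1 hw.2
  rw [h0] at hu0
  rcases hwR with hwR | hwR
  · have hv0 := hγ'.dist_eq_sub le_rfl hv.1 hv.2
    have hs0 := hγ.dist_eq_sub le_rfl hs.1 hs.2
    rw [h0] at hv0
    have h1 := dist_triangle_right (γ 0) (γ' u) (γ w)
    have h2 := dist_triangle (γ 0) (γ' v) (γ s)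
    have h3 := hu.1
    linarith
  · have huL := hγ'.dist_eq_sub (hv.1.trans hu.1) hu.2 le_rfl
    have hwL := hγ.dist_eq_sub hw.1 hw.2 le_rfl
    have hL := hγ.dist_eq_sub le_rfl (hs.1.trans hs.2) le_rfl
    have h1 := infDist_le_dist_of_mem (x := γ 0)
      (mem_image_of_mem l (right_mem_Icc.2 hΛ0))
    rw [hγL'] at huL
    rw [hγL] at hwL hL
    have h2 := dist_triangle (γ 0) (γ' u) (γ w)
    have h3 := dist_triangle4 (l 0) (γ' u) (γ w) (l Λ)
    rw [dist_comm (l 0) (γ' u)] at h3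
    linarith

end Triangle

lemma metricProjSet_image_subset {X : Type*} [PseudoMetricSpace X] {b c : ℝ → X} {L M r : ℝ}
    (h : ∀ s ∈ Icc 0 L, ∀ t ∈ Icc 0 M,
      dist (c t) (b s) = infDist (c t) (b '' Icc 0 L) → s ≤ r ∨ L - r ≤ s) :
    metricProjSet (b '' Icc 0 L) (c '' Icc 0 M) ⊆ b '' Icc 0 r ∪ b '' Icc (L - r) L := by
  intro y hy
  simp only [metricProjSet, mem_iUnion] at hy
  obtain ⟨_, ⟨t, ht, rfl⟩, ⟨s, hs, rfl⟩, hst⟩ := hy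
  exact (h s hs t ht hst).imp (fun hsr => ⟨s, ⟨hs.1, hsr⟩, rfl⟩) fun hsr => ⟨s, ⟨hsr, hs.2⟩, rfl⟩

/-- Lemma 4.14: in a compact `(R,D)`-thin space, let `l` be a segment
of maximal length `Λ ≥ 10R`, `p` a point with `dist(p,l) ≥ 10R`, and `γ₁, γ₂` segments
from `p` to the two endpoints of `l`. Then for any two distinct curves `b₁ ≠ b₂` among
`{γ₁, γ₂, l}`, the projection of `b₂` to `b₁` lies within `3R` of the endpoints of `b₁`. -/
theorem thin_compact_maximal_segment_proj_near_ends
    {X : Type*} [MetricSpace X] {R D : ℝ} (hX : IsThinSpace X R D)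
    (hcpt : IsCompact (Set.univ : Set X))
    {l : ℝ → X} {Λ : ℝ} (hΛ : 10 * R ≤ Λ) (hl : IsSegmentOn l 0 Λ)
    (hmax : ∀ (f : ℝ → X) (a b : ℝ), a ≤ b → IsSegmentOn f a b → b - a ≤ Λ)
    {p : X} (hp : 10 * R ≤ Metric.infDist p (l '' Set.Icc 0 Λ))
    {γ₁ γ₂ : ℝ → X} {L₁ L₂ : ℝ} (hL₁ : 0 ≤ L₁) (hL₂ : 0 ≤ L₂)
    (hγ₁ : IsSegmentOn γ₁ 0 L₁) (hγ₁0 : γ₁ 0 = p) (hγ₁1 : γ₁ L₁ = l Λ)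
    (hγ₂ : IsSegmentOn γ₂ 0 L₂) (hγ₂0 : γ₂ 0 = p) (hγ₂1 : γ₂ L₂ = l 0)
    (b : Fin 3 → ℝ → X) (Len : Fin 3 → ℝ)
    (hb : b = ![γ₁, γ₂, l]) (hLen : Len = ![L₁, L₂, Λ]) :
    ∀ i j : Fin 3, i ≠ j →
      metricProjSet ((b i) '' Set.Icc 0 (Len i)) ((b j) '' Set.Icc 0 (Len j)) ⊆
        (b i) '' Set.Icc 0 (3 * R) ∪ (b i) '' Set.Icc (Len i - 3 * R) (Len i) := by
  have hL₁Λ : L₁ ≤ Λ := by simpa using hmax γ₁ 0 L₁ hL₁ hγ₁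
  have hL₂Λ : L₂ ≤ Λ := by simpa using hmax γ₂ 0 L₂ hL₂ hγ₂
  have hp₁ : 10 * R ≤ infDist (γ₁ 0) (l '' Icc 0 Λ) := by rwa [hγ₁0]
  have hp₂ : 10 * R ≤ infDist (γ₂ 0) ((fun t => l (Λ - t)) '' Icc 0 Λ) := by
    rwa [hγ₂0, image_Icc_zero_sub]
  have hγ₂1' : γ₂ L₂ = (fun t => l (Λ - t)) Λ := by simpa using hγ₂1
  have hγ₁1' : γ₁ L₁ = (fun t => l (Λ - t)) 0 := by simpa using hγ₁1
  have hsub : ∀ t ∈ Icc 0 Λ, Λ - t ∈ Icc 0 Λ := fun t ht =>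
    ⟨by linarith [ht.2], by linarith [ht.1]⟩
  subst hb hLen
  intro i j hij
  apply metricProjSet_image_subset
  intro s hs t ht hst
  fin_cases i <;> fin_cases j
  · exact absurd rfl hij
  · exact hX.proj_side_side_near_ends hΛ hl hL₁Λ hp₁ hγ₁ hγ₁1 hL₂Λ hγ₂ (hγ₂0.trans hγ₁0.symm)
      hγ₂1 hs ht hst
  · exact hX.proj_side_near_ends hΛ hl hL₁Λ hp₁ hγ₁ hγ₁1 hs ht hst
  · exact hX.proj_side_side_near_ends hΛ hl.reverse hL₂Λ hp₂ hγ₂ hγ₂1' hL₁Λ hγ₁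
      (hγ₁0.trans hγ₂0.symm) hγ₁1' hs ht hst
  · exact absurd rfl hij
  · exact hX.proj_side_near_ends hΛ hl.reverse hL₂Λ hp₂ hγ₂ hγ₂1' hs (hsub t ht)
      (by simpa using hst)
  · exact hX.proj_base_near_ends hΛ hl hL₁Λ hp₁ hγ₁ hγ₁1 ht hs hst
  · have h := hX.proj_base_near_ends hΛ hl.reverse hL₂Λ hp₂ hγ₂ hγ₂1' ht (hsub s hs)
      (by rw [image_Icc_zero_sub]; simpa using hst)
    rcases h with h | h
    · exact Or.inr (show Λ - 3 * R ≤ s by linarith)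
    · exact Or.inl (by linarith)
  · exact absurd rfl hij
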